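/- arXiv:2603.28158 — 2 statements merged into one kernel-verified Lean document; each statement's English description precedes it below -/
import Mathlib

section
/- Let C > 0, M ≥ 0 and let G : ℝ → ℝ be measurable with 0 ≤ G(t) ≤ M for a.e. t ∈ ℝ. Suppose that ∫_ℝ G(t)·(ψ'(t) − C·ψ(t)) dt ≥ 0 for every smooth, compactly supported ψ : ℝ → ℝ with ψ ≥ 0. Then G(t) = 0 for a.e. t ∈ ℝ. -/
open Filter Topology MeasureTheory

/-- Gronwall-type vanishing on the whole real line: a nonnegative bounded measurable
function satisfying the distributional inequality `G' + C·G ≤ 0` on `ℝ` (tested against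
nonnegative smooth compactly supported functions) vanishes almost everywhere. -/
theorem gronwall_vanishing
    (C M : ℝ) (hC : 0 < C) (hM : 0 ≤ M)
    (G : ℝ → ℝ) (hGm : Measurable G)
    (hGbd : ∀ᵐ t : ℝ, 0 ≤ G t ∧ G t ≤ M)
    (hdist : ∀ ψ : ℝ → ℝ, ContDiff ℝ (⊤ : ℕ∞) ψ → HasCompactSupport ψ → (∀ t, 0 ≤ ψ t) →
      0 ≤ ∫ t : ℝ, G t * (deriv ψ t - C * ψ t)) :
    ∀ᵐ t : ℝ, G t = 0 := by
  obtain ⟨χ, hχs, hχc, hχ1⟩ : ∃ χ : ℝ → ℝ, ContDiff ℝ (⊤ : ℕ∞) χ ∧ HasCompactSupport χ ∧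
      ∀ x, |x| ≤ 1 → χ x = 1 := by
    let b : ContDiffBump (0 : ℝ) := ⟨1, 2, one_pos, by norm_num⟩
    refine ⟨b, b.contDiff, b.hasCompactSupport, fun x hx => b.one_of_mem_closedBall ?_⟩
    simpa [b] using hx
  set d := deriv χ with hd
  have hdc : Continuous d := hχs.continuous_deriv (by simp)
  have hds : HasCompactSupport d := hχc.deriv
  set K := ∫ t, d t ^ 2 with hK
  have hGint : ∀ f : ℝ → ℝ, Continuous f → HasCompactSupport f →
      Integrable (fun t => G t * f t) := by
    intro f hf hfc
    refine (hf.integrable_of_hasCompactSupport hfc).bdd_mul (c := M)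
      hGm.aestronglyMeasurable ?_
    filter_upwards [hGbd] with t ht
    rw [Real.norm_eq_abs, abs_of_nonneg ht.1]
    exact ht.2
  have key : ∀ n : ℝ, 0 < n → (C / 2) * ∫ t, G t * χ (t / n) ^ 2 ≤ M * (2 / C) * K / n := by
    intro n hn
    have hne : n ≠ 0 := hn.ne'
    have hcomp : ∀ f : ℝ → ℝ, HasCompactSupport f → HasCompactSupport (fun t => f (t / n)) := by
      intro f hf
      have := hf.comp_homeomorph (Homeomorph.mulRight₀ n⁻¹ (inv_ne_zero hne))
      simpa [Function.comp_def, div_eq_mul_inv] using this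
    have hsq : ∀ f : ℝ → ℝ, HasCompactSupport f → HasCompactSupport (fun t => f t ^ 2) := by
      intro f hf
      exact hf.comp_left (g := fun x : ℝ => x ^ 2) (by simp)
    have hψs : ContDiff ℝ (⊤ : ℕ∞) (fun t => χ (t / n) ^ 2) :=
      (hχs.comp (contDiff_id.div_const n)).pow 2
    have hψc : HasCompactSupport (fun t => χ (t / n) ^ 2) := hsq _ (hcomp _ hχc)
    have hder : ∀ t, deriv (fun t => χ (t / n) ^ 2) t = 2 * χ (t / n) * (d (t / n) / n) := by
      intro t
      have h1 : HasDerivAt χ (d (t / n)) (t / n) :=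
        ((hχs.differentiable (by simp)) (t / n)).hasDerivAt
      have h2 : HasDerivAt (fun t : ℝ => t / n) (1 / n) t := (hasDerivAt_id t).div_const n
      have h3 := (h1.comp t h2).pow 2
      have h4 := h3.deriv
      simp only [Function.comp_def] at h4
      refine Eq.trans ?_ (h4.trans ?_)
      · rfl
      · push_cast
        ring
    have h0 := hdist _ hψs hψc (fun t => sq_nonneg _)
    have hi1 : Integrable (fun t => G t * χ (t / n) ^ 2) := hGint _ hψs.continuous hψc
    have hi2 : Integrable (fun t => d (t / n) ^ 2) :=
      ((hdc.comp (continuous_id.div_const n)).pow 2).integrable_of_hasCompactSupport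
        (hsq _ (hcomp _ hds))
    have hi0 : Integrable (fun t => G t * (deriv (fun t => χ (t / n) ^ 2) t
        - C * χ (t / n) ^ 2)) := by
      have := (hGint _ (hψs.continuous_deriv (by simp)) hψc.deriv).sub (hi1.const_mul C)
      refine this.congr (Eventually.of_forall fun t => ?_)
      simp only [Pi.sub_apply]
      ring
    have hle : ∫ t, G t * (deriv (fun t => χ (t / n) ^ 2) t - C * χ (t / n) ^ 2) ≤
        ∫ t, (M * (2 / C) / n ^ 2 * d (t / n) ^ 2 - C / 2 * (G t * χ (t / n) ^ 2)) := by
      refine integral_mono_ae hi0 ((hi2.const_mul _).sub (hi1.const_mul _)) ?_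
      filter_upwards [hGbd] with t ht
      rw [hder]
      have e : 2 * χ (t / n) * (d (t / n) / n) - C * χ (t / n) ^ 2 =
          (2 / C) / n ^ 2 * d (t / n) ^ 2 - C / 2 * χ (t / n) ^ 2 -
          (2 / C) * (d (t / n) / n - C / 2 * χ (t / n)) ^ 2 := by
        field_simp
        ring
      rw [e]
      have a1 : 0 ≤ G t * ((2 / C) * (d (t / n) / n - C / 2 * χ (t / n)) ^ 2) :=
        mul_nonneg ht.1 (by positivity)
      have a2 : G t * ((2 / C) / n ^ 2 * d (t / n) ^ 2) ≤
          M * ((2 / C) / n ^ 2 * d (t / n) ^ 2) :=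
        mul_le_mul_of_nonneg_right ht.2 (by positivity)
      have a3 : M * (2 / C) / n ^ 2 * d (t / n) ^ 2 = M * ((2 / C) / n ^ 2 * d (t / n) ^ 2) := by
        ring
      rw [a3]
      linarith
    rw [integral_sub (hi2.const_mul _) (hi1.const_mul _), integral_const_mul,
      integral_const_mul, Measure.integral_comp_div (fun t => d t ^ 2) n, abs_of_pos hn,
      smul_eq_mul, ← hK] at hle
    have e2 : M * (2 / C) / n ^ 2 * (n * K) = M * (2 / C) * K / n := by
      field_simp
    linarith
  have hzero : ∀ m : ℕ, ∀ᵐ t : ℝ, |t| ≤ m → G t = 0 := by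
    intro m
    have hGloc : IntegrableOn G (Set.Icc (-(m : ℝ)) m) := by
      refine Measure.integrableOn_of_bounded (M := M) (by simp)
        hGm.aestronglyMeasurable ?_
      refine ae_restrict_of_ae ?_
      filter_upwards [hGbd] with t ht
      rw [Real.norm_eq_abs, abs_of_nonneg ht.1]
      exact ht.2
    have hnn : 0 ≤ᵐ[volume.restrict (Set.Icc (-(m : ℝ)) m)] G :=
      ae_restrict_of_ae (hGbd.mono fun t ht => ht.1)
    have hb : ∀ n : ℝ, 0 < n → (m : ℝ) ≤ n →
        ∫ t in Set.Icc (-(m : ℝ)) m, G t ≤ (2 / C) * (M * (2 / C) * K) / n := by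
      intro n hn hmn
      have hk := key n hn
      have hle : ∫ t in Set.Icc (-(m : ℝ)) m, G t ≤ ∫ t, G t * χ (t / n) ^ 2 := by
        have hi1 : Integrable (fun t => G t * χ (t / n) ^ 2) := by
          have h1 := hχc.comp_homeomorph (Homeomorph.mulRight₀ n⁻¹ (inv_ne_zero hn.ne'))
          have h2 := h1.comp_left (g := fun x : ℝ => x ^ 2) (by simp)
          refine hGint _ ((hχs.continuous.comp (continuous_id.div_const n)).pow 2) ?_
          simpa [Function.comp_def, div_eq_mul_inv] using h2
        rw [← integral_indicator measurableSet_Icc]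
        refine integral_mono_ae (hGloc.integrable_indicator measurableSet_Icc) hi1 ?_
        filter_upwards [hGbd] with t ht
        by_cases h : t ∈ Set.Icc (-(m : ℝ)) m
        · rw [Set.indicator_of_mem h, hχ1 (t / n)]
          · simp
          · rw [abs_div, abs_of_pos hn, div_le_one hn]
            exact (abs_le.2 h).trans hmn
        · rw [Set.indicator_of_notMem h]
          exact mul_nonneg ht.1 (sq_nonneg _)
      have : (2 / C) * (M * (2 / C) * K) / n = (2 / C) * (M * (2 / C) * K / n) := by ring
      rw [this]
      calc _ ≤ _ := hle
        _ = (2 / C) * ((C / 2) * ∫ t, G t * χ (t / n) ^ 2) := by field_simp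
        _ ≤ _ := mul_le_mul_of_nonneg_left hk (by positivity)
    have hle0 : ∫ t in Set.Icc (-(m : ℝ)) m, G t ≤ 0 := by
      refine ge_of_tendsto (tendsto_id.const_div_atTop ((2 / C) * (M * (2 / C) * K))) ?_
      filter_upwards [eventually_gt_atTop (0 : ℝ), eventually_ge_atTop (m : ℝ)] with n h1 h2
      exact hb n h1 h2
    have h0 := le_antisymm hle0 (integral_nonneg_of_ae hnn)
    have h1 := (integral_eq_zero_iff_of_nonneg_ae hnn hGloc).1 h0
    have h2 := (ae_restrict_iff' measurableSet_Icc).1 h1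
    filter_upwards [h2] with t ht habs
    exact ht (abs_le.1 habs)
  filter_upwards [ae_all_iff.2 hzero] with t ht
  obtain ⟨m, hm⟩ := exists_nat_ge |t|
  exact ht m hm
end

section
/- Fix Δt > 0, M ≥ 0, τ > 0, and a sequence (a_k)_{k ∈ ℤ} of real numbers with |a_k| ≤ M for all k. Let r be the piecewise constant interpolant and r̃ the piecewise affine interpolant of (a_k). Then there is a constant C, independent of Δt, M, τ, (a_k) and φ, such that for every twice continuously differentiable φ : ℝ → ℝ with support contained in [−τ, τ], |∫_ℝ (r(t) − r̃(t))·φ'(t) dt| ≤ C·M·(1 + τ)·(sup_{t}|φ'(t)| + sup_{t}|φ''(t)|)·Δt. -/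
open Filter Topology MeasureTheory

/-- The piecewise constant interpolant of a sequence `a : ℤ → ℝ` with time step `Δt`:
`r t = a k` for `t ∈ ((k-1)·Δt, k·Δt]`. -/
noncomputable def pcInterp (Δt : ℝ) (a : ℤ → ℝ) (t : ℝ) : ℝ := a ⌈t / Δt⌉

/-- The piecewise affine interpolant of a sequence `a : ℤ → ℝ` with time step `Δt`:
`r̃ t = a (k-1) + (a k - a (k-1)) · (t - (k-1)·Δt)/Δt` for `t ∈ ((k-1)·Δt, k·Δt]`. -/
noncomputable def paInterp (Δt : ℝ) (a : ℤ → ℝ) (t : ℝ) : ℝ :=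
  a (⌈t / Δt⌉ - 1) +
    (a ⌈t / Δt⌉ - a (⌈t / Δt⌉ - 1)) * (t - ((⌈t / Δt⌉ : ℝ) - 1) * Δt) / Δt

/-- `O(Δt)` bound for the time-interpolation consistency error: there is a universal
constant `C` such that for every bounded sequence, every time step and every `C²` test
function supported in `[-τ, τ]`,
`|∫ (r - r̃)·φ'| ≤ C·M·(1+τ)·(sup|φ'| + sup|φ''|)·Δt`. -/
theorem time_interpolation_consistency :
    ∃ C : ℝ, ∀ (Δt M τ : ℝ), 0 < Δt → 0 ≤ M → 0 < τ →
      ∀ a : ℤ → ℝ, (∀ k : ℤ, |a k| ≤ M) →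
      ∀ φ : ℝ → ℝ, ContDiff ℝ 2 φ → Function.support φ ⊆ Set.Icc (-τ) τ →
        |∫ t : ℝ, (pcInterp Δt a t - paInterp Δt a t) * deriv φ t| ≤
          C * M * (1 + τ) * ((⨆ t : ℝ, |deriv φ t|) + ⨆ t : ℝ, |deriv (deriv φ) t|) * Δt := by
  refine ⟨4, ?_⟩
  intro Δt M τ hΔ hM hτ a ha φ hφ hsupp
  have hts : tsupport φ ⊆ Set.Icc (-τ) τ := closure_minimal hsupp isClosed_Icc
  have hcs : HasCompactSupport φ := isCompact_Icc.of_isClosed_subset (isClosed_tsupport φ) hts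
  have hφ1 : ContDiff ℝ 1 (deriv φ) := by
    have h : ContDiff ℝ (1 + 1) φ := by
      rw [one_add_one_eq_two]; exact hφ
    exact (contDiff_succ_iff_deriv.1 h).2.2
  have hc1 : Continuous (deriv φ) := hφ1.continuous
  have hd1 : Differentiable ℝ (deriv φ) := hφ1.differentiable (by norm_num)
  have hc2 : Continuous (deriv (deriv φ)) := hφ1.continuous_deriv (by norm_num)
  have hcs1 : HasCompactSupport (deriv φ) := hcs.deriv
  have hcs2 : HasCompactSupport (deriv (deriv φ)) := hcs1.deriv
  have hz : ∀ t, t ∉ Set.Icc (-τ) τ → deriv φ t = 0 := by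
    intro t ht
    by_contra h
    exact ht (hts (support_deriv_subset (Function.mem_support.2 h)))
  set S1 := ⨆ t : ℝ, |deriv φ t| with hS1
  set S2 := ⨆ t : ℝ, |deriv (deriv φ) t| with hS2
  have hb2 : BddAbove (Set.range fun t => |deriv (deriv φ) t|) := by
    obtain ⟨K, hK⟩ := hcs2.exists_bound_of_continuous hc2
    exact ⟨K, by rintro _ ⟨t, rfl⟩; exact hK t⟩
  have hle2 : ∀ t, |deriv (deriv φ) t| ≤ S2 := fun t => le_ciSup hb2 t
  have hS1n : 0 ≤ S1 := Real.iSup_nonneg fun t => abs_nonneg _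
  have hS2n : 0 ≤ S2 := Real.iSup_nonneg fun t => abs_nonneg _
  have hlip : ∀ t, |deriv φ t - deriv φ (t + Δt)| ≤ S2 * Δt := by
    intro t
    have h := Convex.norm_image_sub_le_of_norm_deriv_le (f := deriv φ) (s := Set.univ) (C := S2)
      (fun x _ => hd1 x) (fun x _ => hle2 x) convex_univ
      (Set.mem_univ (t + Δt)) (Set.mem_univ t)
    have e : ‖t - (t + Δt)‖ = Δt := by
      rw [sub_add_cancel_left, norm_neg, Real.norm_eq_abs, abs_of_pos hΔ]
    rw [e] at h
    exact h
  -- the periodic weight and its product with the interpolant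
  let w : ℝ → ℝ := fun t => (⌈t / Δt⌉ : ℝ) - t / Δt
  have hw0 : ∀ t, 0 ≤ w t := fun t => sub_nonneg.2 (Int.le_ceil _)
  have hw1 : ∀ t, w t ≤ 1 := fun t => by
    have := Int.ceil_lt_add_one (t / Δt)
    simp only [w]; linarith
  let g : ℝ → ℝ := fun t => a ⌈t / Δt⌉ * w t
  let h : ℝ → ℝ := fun t => a (⌈t / Δt⌉ - 1) * w t
  have hceil : Measurable fun t : ℝ => ⌈t / Δt⌉ := (measurable_id.div_const Δt).ceil
  have hwm : Measurable w :=
    ((measurable_of_countable (fun n : ℤ => (n : ℝ))).comp hceil).sub (measurable_id.div_const Δt)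
  have hgm : Measurable g := ((measurable_of_countable a).comp hceil).mul hwm
  have hhm : Measurable h :=
    ((measurable_of_countable (fun n : ℤ => a (n - 1))).comp hceil).mul hwm
  have hbd : ∀ k t, |a k * w t| ≤ M := by
    intro k t
    rw [abs_mul, abs_of_nonneg (hw0 t)]
    calc |a k| * w t ≤ M * 1 := mul_le_mul (ha k) (hw1 t) (hw0 t) hM
      _ = M := mul_one M
  have hint : Integrable (deriv φ) := hc1.integrable_of_hasCompactSupport hcs1
  have hint' : Integrable (fun t => deriv φ (t + Δt)) := hint.comp_add_right Δt
  have i1 : Integrable (fun t => g t * deriv φ t) :=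
    hint.bdd_mul hgm.aestronglyMeasurable (c := M) (Eventually.of_forall fun t => hbd _ t)
  have i2 : Integrable (fun t => h t * deriv φ t) :=
    hint.bdd_mul hhm.aestronglyMeasurable (c := M) (Eventually.of_forall fun t => hbd _ t)
  have i3 : Integrable (fun t => g t * deriv φ (t + Δt)) :=
    hint'.bdd_mul hgm.aestronglyMeasurable (c := M) (Eventually.of_forall fun t => hbd _ t)
  have hshift : ∀ t, h (t + Δt) = g t := by
    intro t
    have e : (t + Δt) / Δt = t / Δt + 1 := by field_simp
    simp only [h, g, w, e, Int.ceil_add_one, add_sub_cancel_right]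
    push_cast
    ring
  have hE : ∫ t : ℝ, (pcInterp Δt a t - paInterp Δt a t) * deriv φ t
      = ∫ t : ℝ, g t * (deriv φ t - deriv φ (t + Δt)) := by
    have e1 : ∀ t, (pcInterp Δt a t - paInterp Δt a t) * deriv φ t
        = g t * deriv φ t - h t * deriv φ t := by
      intro t
      simp only [pcInterp, paInterp, g, h, w]
      field_simp
      ring
    have e2 : ∫ t, h t * deriv φ t = ∫ t, g t * deriv φ (t + Δt) := by
      rw [← integral_add_right_eq_self (fun t => h t * deriv φ t) Δt]
      simp only [hshift]
    simp only [e1, mul_sub]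
    rw [integral_sub i1 i2, integral_sub i1 i3, e2]
  rw [hE]
  let I : ℝ → ℝ := (Set.Icc (-τ) τ).indicator fun _ => M * (S2 * Δt)
  have hMS : 0 ≤ M * (S2 * Δt) := by positivity
  have hI0 : ∀ t, 0 ≤ I t := fun t => Set.indicator_nonneg (fun _ _ => hMS) t
  have hI : Integrable I :=
    (integrable_indicator_iff measurableSet_Icc).2 (integrableOn_const (by simp))
  have hI' : Integrable (fun t => I (t + Δt)) := hI.comp_add_right Δt
  have hIv : ∫ t, I t = 2 * τ * (M * (S2 * Δt)) := by
    simp only [I]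
    rw [integral_indicator measurableSet_Icc, setIntegral_const, smul_eq_mul,
      Real.volume_real_Icc_of_le (by linarith)]
    ring
  have hpt : ∀ t, ‖g t * (deriv φ t - deriv φ (t + Δt))‖ ≤ I t + I (t + Δt) := by
    intro t
    have hB : ‖g t * (deriv φ t - deriv φ (t + Δt))‖ ≤ M * (S2 * Δt) := by
      rw [norm_mul]
      exact mul_le_mul (hbd _ t) (hlip t) (norm_nonneg _) hM
    by_cases h1 : t ∈ Set.Icc (-τ) τ
    · have : I t = M * (S2 * Δt) := Set.indicator_of_mem h1 _
      linarith [hI0 (t + Δt)]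
    · by_cases h2 : t + Δt ∈ Set.Icc (-τ) τ
      · have : I (t + Δt) = M * (S2 * Δt) := Set.indicator_of_mem h2 _
        linarith [hI0 t]
      · rw [hz _ h1, hz _ h2]
        simpa using add_nonneg (hI0 t) (hI0 (t + Δt))
  have hfin := norm_integral_le_of_norm_le (hI.add hI') (Eventually.of_forall hpt)
  have hsum : ∫ t, (I + fun t => I (t + Δt)) t = 4 * τ * (M * (S2 * Δt)) := by
    rw [integral_add' hI hI', integral_add_right_eq_self I Δt, hIv]
    ring
  rw [hsum, Real.norm_eq_abs] at hfin
  refine hfin.trans ?_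
  have p1 : 0 ≤ M * S2 * Δt := by positivity
  have p2 : 0 ≤ M * (1 + τ) * S1 * Δt := by positivity
  nlinarith
end
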